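/- For all reals a > 0 and S > 0, (1/3)·(∂_S ∂_T x)(S,T,a) evaluated at T = S equals 2 a^3 e^{−2aS}(1 + e^{−2aS}) / (1 − e^{−2aS})^3. -/

import Mathlib

/-- The scaling function
`x(S,T,a) = −3a − 6a(e^{−aS} + e^{−aT} − 3e^{−a(S+T)} + e^{−2a(S+T)}) /
  ((1−e^{−aS})(1−e^{−aT})(1−e^{−a(S+T)}))`. -/
noncomputable def xscal (a S T : ℝ) : ℝ :=
  -3 * a - 6 * a *
    (Real.exp (-a * S) + Real.exp (-a * T) - 3 * Real.exp (-a * (S + T)) +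
      Real.exp (-2 * a * (S + T))) /
    ((1 - Real.exp (-a * S)) * (1 - Real.exp (-a * T)) * (1 - Real.exp (-a * (S + T))))

lemma xscal_eq (a u v : ℝ) (ha : 0 < a) (hu : 0 < u) (hv : 0 < v) :
    xscal a u v = -3 * a - 6 * a * ((1 - Real.exp (-a * u))⁻¹ + (1 - Real.exp (-a * v))⁻¹
      - (1 - Real.exp (-a * (u + v)))⁻¹ - 1) := by
  have key : ∀ w : ℝ, 0 < w → 1 - Real.exp (-a * w) ≠ 0 := by
    intro w hw
    have : Real.exp (-a * w) < 1 := by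
      rw [Real.exp_lt_one_iff]; nlinarith [mul_pos ha hw]
    linarith
  have h1 := key u hu
  have h2 := key v hv
  have h3 := key (u + v) (by linarith)
  have e1 : Real.exp (-a * (u + v)) = Real.exp (-a * u) * Real.exp (-a * v) := by
    rw [← Real.exp_add]; ring_nf
  have e2 : Real.exp (-2 * a * (u + v)) = (Real.exp (-a * u) * Real.exp (-a * v)) ^ 2 := by
    rw [← Real.exp_add, ← Real.exp_nat_mul]; push_cast; ring_nf
  unfold xscal
  rw [e2]
  rw [e1] at h3 ⊢
  generalize Real.exp (-a * u) = p at *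
  generalize Real.exp (-a * v) = q at *
  field_simp
  ring

lemma one_sub_exp_ne (a w : ℝ) (ha : 0 < a) (hw : 0 < w) : 1 - Real.exp (-a * w) ≠ 0 := by
  have : Real.exp (-a * w) < 1 := by
    rw [Real.exp_lt_one_iff]; nlinarith [mul_pos ha hw]
  linarith

lemma hasDerivAt_aux (a c v : ℝ) :
    HasDerivAt (fun v : ℝ => 1 - Real.exp (-a * (c + v))) (a * Real.exp (-a * (c + v))) v := by
  have h := ((((hasDerivAt_id v).const_add c).const_mul (-a)).exp).const_sub 1
  exact h.congr_deriv (by simp only [id]; ring)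

lemma inner_deriv (a u S : ℝ) (ha : 0 < a) (hu : 0 < u) (hS : 0 < S) :
    deriv (fun v : ℝ => xscal a u v) S =
      -6 * a * (-(a * Real.exp (-a * (0 + S))) / (1 - Real.exp (-a * (0 + S))) ^ 2
        + a * Real.exp (-a * (S + u)) / (1 - Real.exp (-a * (S + u))) ^ 2) := by
  have hev : (fun v : ℝ => xscal a u v) =ᶠ[nhds S] fun v =>
      -3 * a - 6 * a * ((1 - Real.exp (-a * u))⁻¹ + (1 - Real.exp (-a * (0 + v)))⁻¹
      - (1 - Real.exp (-a * (u + v)))⁻¹ - 1) := by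
    filter_upwards [lt_mem_nhds hS] with v hv
    rw [xscal_eq a u v ha hu hv, zero_add]
  rw [hev.deriv_eq]
  have h1 := (hasDerivAt_aux a 0 S).fun_inv (one_sub_exp_ne a _ ha (by linarith))
  have h2 := (hasDerivAt_aux a u S).fun_inv (one_sub_exp_ne a _ ha (by linarith))
  have h := ((((h1.const_add (1 - Real.exp (-a * u))⁻¹).sub h2).sub_const 1).const_mul
    (6 * a)).const_sub (-3 * a)
  refine h.deriv.trans ?_
  rw [add_comm u S]
  ring

theorem mixed_deriv_xscal_diag (a S : ℝ) (ha : 0 < a) (hS : 0 < S) :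
    (1/3) * deriv (fun u : ℝ => deriv (fun v : ℝ => xscal a u v) S) S =
      2 * a ^ 3 * Real.exp (-2 * a * S) * (1 + Real.exp (-2 * a * S)) /
        (1 - Real.exp (-2 * a * S)) ^ 3 := by
  have hev : (fun u : ℝ => deriv (fun v : ℝ => xscal a u v) S) =ᶠ[nhds S] fun u =>
      -6 * a * (-(a * Real.exp (-a * (0 + S))) / (1 - Real.exp (-a * (0 + S))) ^ 2
        + a * (1 - (1 - Real.exp (-a * (S + u)))) / (1 - Real.exp (-a * (S + u))) ^ 2) := by
    filter_upwards [lt_mem_nhds hS] with u hu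
    rw [inner_deriv a u S ha hu hS, sub_sub_cancel]
  rw [hev.deriv_eq]
  have hne := one_sub_exp_ne a (S + S) ha (by linarith)
  have h0 := hasDerivAt_aux a S S
  have h := ((((h0.const_sub 1).const_mul a).fun_div (h0.fun_pow 2) (pow_ne_zero 2 hne)).const_add
    (-(a * Real.exp (-a * (0 + S))) / (1 - Real.exp (-a * (0 + S))) ^ 2)).const_mul (-6 * a)
  rw [h.deriv]
  have e : -2 * a * S = -a * (S + S) := by ring
  rw [e]
  generalize Real.exp (-a * (S + S)) = p at *
  field_simp
  ring
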